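/- Let m, p, q, r, s be positive integers with q > p ≥ m and q > r + s, such that m ≠ s, ps ≠ m(q − r), qs ≠ m(q − r), m(p − r) ≠ ps, and the four points (p,0), (q,0), (0,m), (r,s) are in convex position (each is a vertex of their convex hull). Set t* = (ps − m(q − r))/(qs − m(q − r)) and τ = (m − s)·t*/m. Then τ ∉ {0, 1} and t* ∉ {0, 1, τ}; moreover, for any nonzero complex numbers α, β, the functions x(t) = α t^m (t − τ)^{−s} and y(t) = β t^p (t − 1)^{q−p} (t − τ)^{r−q} satisfy x′(t*) = y′(t*) = 0, and the two vectors (x″(t*), y″(t*)) and (x‴(t*), y‴(t*)) in ℂ² are linearly independent over ℂ. -/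

import Mathlib

open Filter Topology in
/-- The first three derivatives of `f` at a zero of its logarithmic derivative `L`. -/
theorem deriv_at_zero_of_logDeriv {f L L₁ : ℂ → ℂ} {a l₂ : ℂ}
    (hf : ∀ᶠ z in 𝓝 a, HasDerivAt f (f z * L z) z)
    (hL : ∀ᶠ z in 𝓝 a, HasDerivAt L (L₁ z) z)
    (hL₁ : HasDerivAt L₁ l₂ a) (ha : L a = 0) :
    deriv f a = 0 ∧ deriv (deriv f) a = f a * L₁ a ∧
      deriv (deriv (deriv f)) a = f a * l₂ := by
  have e1 : deriv f =ᶠ[𝓝 a] fun z => f z * L z := hf.mono fun z h => h.deriv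
  have e2 : deriv (deriv f) =ᶠ[𝓝 a] fun z => f z * L z * L z + f z * L₁ z := by
    filter_upwards [e1.eventuallyEq_nhds, hf, hL] with z h1 h2 h3
    rw [h1.deriv_eq]
    exact (h2.mul h3).deriv
  refine ⟨by simp [e1.eq_of_nhds, ha], by simp [e2.eq_of_nhds, ha], ?_⟩
  have hfa := hf.self_of_nhds
  have hLa := hL.self_of_nhds
  rw [e2.deriv_eq]
  refine (((hfa.mul hLa).mul hLa).add (hfa.mul hL₁)).deriv.trans ?_
  simp [ha]

/-- A monomial shifted by `w` has logarithmic derivative `n / (z - w)`. -/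
theorem hasDerivAt_sub_zpow (n : ℤ) {w z : ℂ} (h : z - w ≠ 0) :
    HasDerivAt (fun z : ℂ => (z - w) ^ n) ((z - w) ^ n * (n / (z - w))) z := by
  have := (hasDerivAt_zpow n (z - w) (Or.inl h)).comp z ((hasDerivAt_id z).sub_const w)
  refine this.congr_deriv ?_
  rw [zpow_sub_one₀ h]
  ring

theorem hasDerivAt_const_div_sub_pow (c : ℂ) (k : ℕ) {w z : ℂ} (h : z - w ≠ 0) :
    HasDerivAt (fun z : ℂ => c / (z - w) ^ k) (-(k * c) / (z - w) ^ (k + 1)) z := by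
  have := (hasDerivAt_const z c).div (((hasDerivAt_id z).sub_const w).pow k) (pow_ne_zero k h)
  refine this.congr_deriv ?_
  rcases k with _ | k
  · simp
  · simp only [id, Nat.add_sub_cancel, Pi.pow_apply]
    field_simp
    ring

open Filter Topology in
/-- Derivatives of `γ z^a (z-1)^b (z-w)^c` at a zero `t` of its logarithmic derivative. -/
theorem deriv_zpow_mul_at_critical (γ w : ℂ) (a b c : ℤ) {t : ℂ} (h0 : t ≠ 0) (h1 : t ≠ 1)
    (hw : t ≠ w) (hcrit : (a : ℂ) / t + b / (t - 1) + c / (t - w) = 0) :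
    deriv (fun z : ℂ => γ * z ^ a * (z - 1) ^ b * (z - w) ^ c) t = 0 ∧
    deriv (deriv (fun z : ℂ => γ * z ^ a * (z - 1) ^ b * (z - w) ^ c)) t =
      γ * t ^ a * (t - 1) ^ b * (t - w) ^ c *
        (-(a / t ^ 2 + b / (t - 1) ^ 2 + c / (t - w) ^ 2)) ∧
    deriv (deriv (deriv (fun z : ℂ => γ * z ^ a * (z - 1) ^ b * (z - w) ^ c))) t =
      γ * t ^ a * (t - 1) ^ b * (t - w) ^ c *
        (2 * (a / t ^ 3 + b / (t - 1) ^ 3 + c / (t - w) ^ 3)) := by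
  have ev : ∀ᶠ z in 𝓝 t, z - 0 ≠ 0 ∧ z - 1 ≠ 0 ∧ z - w ≠ 0 := by
    filter_upwards [eventually_ne_nhds h0, eventually_ne_nhds h1, eventually_ne_nhds hw]
      with z x0 x1 xw
    exact ⟨by simpa using x0, sub_ne_zero.2 x1, sub_ne_zero.2 xw⟩
  refine deriv_at_zero_of_logDeriv
    (L := fun z => a / z + b / (z - 1) + c / (z - w))
    (L₁ := fun z => -(a / z ^ 2 + b / (z - 1) ^ 2 + c / (z - w) ^ 2)) ?_ ?_ ?_ hcrit
  · filter_upwards [ev] with z ⟨x0, x1, xw⟩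
    have := (((hasDerivAt_sub_zpow a x0).const_mul γ).mul (hasDerivAt_sub_zpow b x1)).mul
      (hasDerivAt_sub_zpow c xw)
    simp only [sub_zero] at this
    refine this.congr_deriv ?_
    simp only [Pi.mul_apply]
    ring
  · filter_upwards [ev] with z ⟨x0, x1, xw⟩
    have := ((hasDerivAt_const_div_sub_pow a 1 x0).add
      (hasDerivAt_const_div_sub_pow b 1 x1)).add (hasDerivAt_const_div_sub_pow c 1 xw)
    simp only [sub_zero, pow_one] at this
    refine this.congr_deriv ?_
    push_cast
    ring
  · obtain ⟨x0, x1, xw⟩ := ev.self_of_nhds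
    have := (((hasDerivAt_const_div_sub_pow a 2 x0).add
      (hasDerivAt_const_div_sub_pow b 2 x1)).add (hasDerivAt_const_div_sub_pow c 2 xw)).neg
    simp only [sub_zero] at this
    refine this.congr_deriv ?_
    push_cast
    ring

/-- Two vectors of `K²` with nonzero determinant are linearly independent. -/
theorem linearIndependent_pair_of_det_ne_zero {K : Type*} [Field K] {a b c d : K}
    (h : a * d - b * c ≠ 0) : LinearIndependent K ![(a, b), (c, d)] := by
  rw [LinearIndependent.pair_iff]
  intro u v huv
  simp only [Prod.smul_mk, Prod.mk_add_mk, Prod.mk_eq_zero, smul_eq_mul] at huv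
  obtain ⟨e1, e2⟩ := huv
  constructor
  · refine (mul_eq_zero.1 (?_ : u * (a * d - b * c) = 0)).resolve_right h
    linear_combination d * e1 - c * e2
  · refine (mul_eq_zero.1 (?_ : v * (a * d - b * c) = 0)).resolve_right h
    linear_combination a * e2 - b * e1


/-- Under the nondegeneracy conditions `m ≠ s`, `ps ≠ m(q-r)`,
`qs ≠ m(q-r)`, `m(p-r) ≠ ps`, and assuming the four points `(p,0), (q,0), (0,m), (r,s)`
are in convex position (each is an extreme point of their convex hull), setting
`t* = (ps - m(q-r))/(qs - m(q-r))` and `τ = (m - s)·t*/m`, one has `τ ∉ {0,1}`,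
`t* ∉ {0,1,τ}`, and for any nonzero `α, β` the parametrization
`x(t) = α t^m (t-τ)^{-s}`, `y(t) = β t^p (t-1)^{q-p} (t-τ)^{r-q}` satisfies
`x'(t*) = y'(t*) = 0` while the vectors `(x''(t*), y''(t*))` and `(x'''(t*), y'''(t*))`
are linearly independent over ℂ. -/
theorem stmt_3 (m p q r s : ℕ) (hm : 0 < m) (hp : 0 < p) (hq : 0 < q) (hr : 0 < r)
    (hs : 0 < s) (hqp : p < q) (hpm : m ≤ p) (hqrs : r + s < q)
    (hms : m ≠ s)
    (h1 : (p : ℤ) * s ≠ m * ((q : ℤ) - r))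
    (h2 : (q : ℤ) * s ≠ m * ((q : ℤ) - r))
    (h3 : (m : ℤ) * ((p : ℤ) - r) ≠ (p : ℤ) * s)
    (hconv : ∀ x ∈ ({((p : ℝ), (0 : ℝ)), ((q : ℝ), (0 : ℝ)), ((0 : ℝ), (m : ℝ)),
        ((r : ℝ), (s : ℝ))} : Set (ℝ × ℝ)),
      x ∈ Set.extremePoints ℝ (convexHull ℝ
        ({((p : ℝ), (0 : ℝ)), ((q : ℝ), (0 : ℝ)), ((0 : ℝ), (m : ℝ)),
          ((r : ℝ), (s : ℝ))} : Set (ℝ × ℝ))))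
    (tstar τ : ℂ)
    (htstar : tstar = ((p : ℂ) * s - m * ((q : ℂ) - r)) / ((q : ℂ) * s - m * ((q : ℂ) - r)))
    (hτ : τ = ((m : ℂ) - s) * tstar / m) :
    τ ≠ 0 ∧ τ ≠ 1 ∧ tstar ≠ 0 ∧ tstar ≠ 1 ∧ tstar ≠ τ ∧
    ∀ α β : ℂ, α ≠ 0 → β ≠ 0 →
      (deriv (fun z : ℂ => α * z ^ (m : ℤ) * (z - τ) ^ (-(s : ℤ))) tstar = 0 ∧
       deriv (fun z : ℂ =>
          β * z ^ (p : ℤ) * (z - 1) ^ ((q : ℤ) - (p : ℤ)) * (z - τ) ^ ((r : ℤ) - (q : ℤ)))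
          tstar = 0 ∧
       LinearIndependent ℂ
        ![(deriv (deriv (fun z : ℂ => α * z ^ (m : ℤ) * (z - τ) ^ (-(s : ℤ)))) tstar,
           deriv (deriv (fun z : ℂ =>
             β * z ^ (p : ℤ) * (z - 1) ^ ((q : ℤ) - (p : ℤ)) * (z - τ) ^ ((r : ℤ) - (q : ℤ))))
             tstar),
          (deriv (deriv (deriv (fun z : ℂ => α * z ^ (m : ℤ) * (z - τ) ^ (-(s : ℤ))))) tstar,
           deriv (deriv (deriv (fun z : ℂ =>
             β * z ^ (p : ℤ) * (z - 1) ^ ((q : ℤ) - (p : ℤ)) * (z - τ) ^ ((r : ℤ) - (q : ℤ)))))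
             tstar)]) := by
  have c1 : (p : ℂ) * s - m * ((q : ℂ) - r) ≠ 0 := sub_ne_zero.2 (by exact_mod_cast h1)
  have c2 : (q : ℂ) * s - m * ((q : ℂ) - r) ≠ 0 := sub_ne_zero.2 (by exact_mod_cast h2)
  have c3 : (m : ℂ) * ((p : ℂ) - r) - p * s ≠ 0 := sub_ne_zero.2 (by exact_mod_cast h3)
  have cm : (m : ℂ) ≠ 0 := by exact_mod_cast hm.ne'
  have cs : (s : ℂ) ≠ 0 := by exact_mod_cast hs.ne'
  have cms : (m : ℂ) - s ≠ 0 := sub_ne_zero.2 (by exact_mod_cast hms)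
  have cqp : (q : ℂ) - p ≠ 0 := sub_ne_zero.2 (by exact_mod_cast hqp.ne')
  have ht0 : tstar ≠ 0 := htstar ▸ div_ne_zero c1 c2
  have e1 : tstar - 1 = -(((q : ℂ) - p) * s) / ((q : ℂ) * s - m * ((q : ℂ) - r)) := by
    rw [htstar, div_sub_one c2]
    ring
  have eτ : tstar - τ = s * tstar / m := by
    rw [hτ]
    field_simp
    ring
  have eτ1 : τ - 1 = s * ((m : ℂ) * ((p : ℂ) - r) - p * s) /
      (m * ((q : ℂ) * s - m * ((q : ℂ) - r))) := by
    have ht := (eq_div_iff c2).1 htstar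
    rw [eq_div_iff (mul_ne_zero cm c2)]
    linear_combination ((q : ℂ) * s - m * ((q : ℂ) - r)) * (eq_div_iff cm).1 hτ + (m - s) * ht
  have ht1' : tstar - 1 ≠ 0 := by
    rw [e1]
    exact div_ne_zero (neg_ne_zero.2 (mul_ne_zero cqp cs)) c2
  have htτ' : tstar - τ ≠ 0 := by
    rw [eτ]
    exact div_ne_zero (mul_ne_zero cs ht0) cm
  have ht1 := sub_ne_zero.1 ht1'
  have htτ := sub_ne_zero.1 htτ'
  refine ⟨hτ ▸ div_ne_zero (mul_ne_zero cms ht0) cm, sub_ne_zero.1 ?_, ht0, ht1, htτ, ?_⟩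
  · rw [eτ1]
    exact div_ne_zero (mul_ne_zero cs c3) (mul_ne_zero cm c2)
  intro α β hα hβ
  have hx := deriv_zpow_mul_at_critical α τ m 0 (-s) ht0 ht1 htτ (by
    rw [eτ]
    push_cast
    field_simp
    ring)
  have hy := deriv_zpow_mul_at_critical β τ p (q - p) (r - q) ht0 ht1 htτ (by
    rw [eτ, e1, htstar]
    push_cast
    field_simp
    ring)
  simp only [zpow_zero, mul_one] at hx
  obtain ⟨hx1, hx2, hx3⟩ := hx
  obtain ⟨hy1, hy2, hy3⟩ := hy
  refine ⟨hx1, hy1, linearIndependent_pair_of_det_ne_zero ?_⟩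
  rw [hx2, hx3, hy2, hy3]
  have hX : α * tstar ^ (m : ℤ) * (tstar - τ) ^ (-(s : ℤ)) ≠ 0 :=
    mul_ne_zero (mul_ne_zero hα (zpow_ne_zero _ ht0)) (zpow_ne_zero _ htτ')
  have hY : β * tstar ^ (p : ℤ) * (tstar - 1) ^ ((q : ℤ) - (p : ℤ)) *
      (tstar - τ) ^ ((r : ℤ) - (q : ℤ)) ≠ 0 :=
    mul_ne_zero (mul_ne_zero (mul_ne_zero hβ (zpow_ne_zero _ ht0)) (zpow_ne_zero _ ht1'))
      (zpow_ne_zero _ htτ')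
  generalize α * tstar ^ (m : ℤ) * (tstar - τ) ^ (-(s : ℤ)) = X at hX ⊢
  generalize β * tstar ^ (p : ℤ) * (tstar - 1) ^ ((q : ℤ) - (p : ℤ)) *
      (tstar - τ) ^ ((r : ℤ) - (q : ℤ)) = Y at hY ⊢
  push_cast
  have et : ((q : ℂ) - p) / (tstar - 1) =
      (m * ((q : ℂ) - r) - p * s) / (s * tstar) := by
    rw [e1, htstar]
    field_simp
    ring
  have b2 : ((q : ℂ) - p) / (tstar - 1) ^ 2 =
      ((m * ((q : ℂ) - r) - p * s) / (s * tstar)) ^ 2 / ((q : ℂ) - p) := by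
    rw [← et]
    field_simp
  have b3 : ((q : ℂ) - p) / (tstar - 1) ^ 3 =
      ((m * ((q : ℂ) - r) - p * s) / (s * tstar)) ^ 3 / ((q : ℂ) - p) ^ 2 := by
    rw [← et]
    field_simp
  rw [b2, b3, eτ]
  have key : ∀ D : ℂ, D = X * Y * (2 * m * (m - s) * (p * s - m * ((q : ℂ) - r)) *
      ((q : ℂ) * s - m * ((q : ℂ) - r)) * (m * ((p : ℂ) - r) - p * s) /
      (s ^ 4 * ((q : ℂ) - p) ^ 2 * tstar ^ 5)) → D ≠ 0 := by
    rintro D rfl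
    refine mul_ne_zero (mul_ne_zero hX hY) (div_ne_zero ?_ ?_)
    · exact mul_ne_zero (mul_ne_zero (mul_ne_zero (mul_ne_zero (mul_ne_zero two_ne_zero cm) cms)
        c1) c2) c3
    · exact mul_ne_zero (mul_ne_zero (pow_ne_zero _ cs) (pow_ne_zero _ cqp)) (pow_ne_zero _ ht0)
  refine key _ ?_
  field_simp
  ring
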